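/- With notation as in the setup, assume in addition that W is infinite. Then D^J(w_a w_b) = S_a; that is, for s ∈ S we have s (w_a w_b) W_J ≤_J (w_a w_b) W_J if and only if s ≠ a. -/

import Mathlib

namespace CoxeterSystem

variable {B : Type*} {W : Type*} [Group W] {M : CoxeterMatrix B}

/-- The standard parabolic subgroup `W_T` of `W`, generated by the simple reflections
indexed by `T ⊆ B`. -/
def parabolic (cs : CoxeterSystem M W) (T : Set B) : Subgroup W :=
  Subgroup.closure (cs.simple '' T)

/-- The Bruhat order on `W`: `u ≤ w` iff some reduced word for `w` contains a subword whose
product is `u`. -/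
def bruhatLE (cs : CoxeterSystem M W) (u w : W) : Prop :=
  ∃ ω : List B, cs.IsReduced ω ∧ cs.wordProd ω = w ∧
    ∃ ω' : List B, ω'.Sublist ω ∧ cs.wordProd ω' = u

/-- `u` is the minimal-length representative `min (w W_T)` of the coset `w W_T`. -/
def IsMinRep (cs : CoxeterSystem M W) (T : Set B) (w u : W) : Prop :=
  w⁻¹ * u ∈ cs.parabolic T ∧
    ∀ v : W, w⁻¹ * v ∈ cs.parabolic T → cs.length u ≤ cs.length v

/-- The Bruhat order on `W / W_T`: `u W_T ≤_T w W_T` iff `min (u W_T) ≤ min (w W_T)` in the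
Bruhat order on `W`. -/
def bruhatLEQuot (cs : CoxeterSystem M W) (T : Set B) (u w : W) : Prop :=
  ∃ u' w' : W, cs.IsMinRep T u u' ∧ cs.IsMinRep T w w' ∧ cs.bruhatLE u' w'

/-- The support of `w`: the set of simple reflections occurring in some reduced word
for `w`. -/
def support (cs : CoxeterSystem M W) (w : W) : Set B :=
  {i | ∃ ω : List B, cs.IsReduced ω ∧ cs.wordProd ω = w ∧ i ∈ ω}

end CoxeterSystem

namespace CoxeterSystem

variable {B : Type*} {W : Type*} [Group W] {M : CoxeterMatrix B} (cs : CoxeterSystem M W)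

section StrongExchange

open Classical in
/-- The action of a simple reflection on pairs of an element of `W` and a sign, which conjugates the
element and flips the sign if the element is the given simple reflection. -/
noncomputable def signedConj (i : B) : Function.End (W × ZMod 2) :=
  fun p ↦ (cs.simple i * p.1 * cs.simple i, p.2 + if p.1 = cs.simple i then 1 else 0)

open Classical in
theorem signedConj_mul_pow_apply (i j : B) (m : ℕ) (r : W) (e : ZMod 2) :
    ((cs.signedConj i * cs.signedConj j) ^ m) (r, e) =
      ((cs.simple i * cs.simple j) ^ m * r * ((cs.simple i * cs.simple j) ^ m)⁻¹,
        e + ∑ n ∈ Finset.range (2 * m),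
          if r = cs.simple j * (cs.simple i * cs.simple j) ^ n then 1 else 0) := by
  induction m with
  | zero => simp [Function.End.one_def]
  | succ m ih =>
    set x := cs.simple i * cs.simple j with hx
    have hconj (n : ℕ) : x ^ n * cs.simple j * x ^ n = cs.simple j := by
      induction n with
      | zero => simp
      | succ n ihn =>
        rw [pow_succ x n]
        nth_rw 2 [← pow_succ x n]
        rw [pow_succ' x n]
        calc x ^ n * x * cs.simple j * (x * x ^ n)
            = x ^ n * (x * cs.simple j * x) * x ^ n := by group
          _ = cs.simple j := by
              rw [show x * cs.simple j * x = cs.simple j by simp [hx, mul_assoc], ihn]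
    have hinv : (x ^ m)⁻¹ * cs.simple j = cs.simple j * x ^ m := by
      rw [inv_mul_eq_iff_eq_mul, ← mul_assoc, hconj]
    have h1 : (x ^ m * r * (x ^ m)⁻¹ = cs.simple j) ↔ r = cs.simple j * x ^ (2 * m) := by
      rw [mul_inv_eq_iff_eq_mul, ← eq_inv_mul_iff_mul_eq, ← mul_assoc, hinv, mul_assoc, ← pow_add,
        two_mul]
    have h2 : (cs.simple j * (x ^ m * r * (x ^ m)⁻¹) * cs.simple j = cs.simple i) ↔
        r = cs.simple j * x ^ (2 * m + 1) := by
      have : (cs.simple j * (x ^ m * r * (x ^ m)⁻¹) * cs.simple j = cs.simple i) ↔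
          x ^ m * r * (x ^ m)⁻¹ = cs.simple j * x := by
        rw [← eq_mul_inv_iff_mul_eq, inv_simple, ← eq_inv_mul_iff_mul_eq, inv_simple]
      rw [this, mul_inv_eq_iff_eq_mul, ← eq_inv_mul_iff_mul_eq, ← mul_assoc, ← mul_assoc, hinv,
        mul_assoc, mul_assoc, ← pow_succ', ← pow_add]
      congr! 3
      omega
    rw [pow_succ']
    change (cs.signedConj i * cs.signedConj j)
      (((cs.signedConj i * cs.signedConj j) ^ m) (r, e)) = _
    rw [ih]
    change cs.signedConj i (cs.signedConj j _) = _
    simp only [signedConj, h1, h2]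
    rw [show 2 * (m + 1) = 2 * m + 1 + 1 by ring, Finset.sum_range_succ, Finset.sum_range_succ]
    refine Prod.ext ?_ ?_
    · have hx' : x⁻¹ = cs.simple j * cs.simple i := by simp [hx]
      rw [pow_succ' x m, mul_inv_rev, hx', hx]
      simp only [mul_assoc]
    · simp only [add_assoc]

theorem isLiftable_signedConj : M.IsLiftable cs.signedConj := by
  classical
  intro i j
  funext ⟨r, e⟩
  rw [signedConj_mul_pow_apply, simple_mul_simple_pow, two_mul, Finset.sum_range_add]
  simp only [pow_add, simple_mul_simple_pow, one_mul, CharTwo.add_self_eq_zero]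
  simp [Function.End.one_def]

/-- The extension of `signedConj` to an action of `W`. -/
noncomputable def signedConjHom : W →* Function.End (W × ZMod 2) :=
  cs.lift ⟨cs.signedConj, cs.isLiftable_signedConj⟩

open Classical in
theorem signedConjHom_wordProd (ω : List B) (r : W) (e : ZMod 2) :
    cs.signedConjHom (cs.wordProd ω) (r, e) =
      (cs.wordProd ω * r * (cs.wordProd ω)⁻¹, e + ((cs.rightInvSeq ω).count r : ZMod 2)) := by
  induction ω with
  | nil => simp [Function.End.one_def]
  | cons i ω ih =>
    rw [wordProd_cons, map_mul]
    change cs.signedConjHom (cs.simple i) (cs.signedConjHom (cs.wordProd ω) (r, e)) = _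
    rw [ih, signedConjHom, lift_apply_simple]
    have h : (cs.wordProd ω * r * (cs.wordProd ω)⁻¹ = cs.simple i) ↔
        (cs.wordProd ω)⁻¹ * cs.simple i * cs.wordProd ω = r := by
      rw [mul_inv_eq_iff_eq_mul, mul_assoc, inv_mul_eq_iff_eq_mul, eq_comm]
    simp only [signedConj, rightInvSeq, List.count_cons, h, beq_iff_eq]
    refine Prod.ext (by simp [mul_assoc]) ?_
    simp [add_assoc]

theorem signedConjHom_apply_add (w r : W) (e f : ZMod 2) :
    cs.signedConjHom w (r, e + f) =
      ((cs.signedConjHom w (r, e)).1, (cs.signedConjHom w (r, e)).2 + f) := by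
  classical
  obtain ⟨ω, rfl⟩ := cs.wordProd_surjective w
  simp only [signedConjHom_wordProd]
  refine Prod.ext rfl ?_
  dsimp only
  ring

theorem signedConjHom_apply_fst (w r : W) (e : ZMod 2) :
    (cs.signedConjHom w (r, e)).1 = w * r * w⁻¹ := by
  classical
  obtain ⟨ω, rfl⟩ := cs.wordProd_surjective w
  simp only [signedConjHom_wordProd]

theorem signedConjHom_mul_apply (v w : W) (p : W × ZMod 2) :
    cs.signedConjHom (v * w) p = cs.signedConjHom v (cs.signedConjHom w p) := by
  rw [map_mul]
  rfl

theorem IsReflection.signedConjHom_apply {t : W} (ht : cs.IsReflection t) (e : ZMod 2) :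
    cs.signedConjHom t (t, e) = (t, e + 1) := by
  obtain ⟨u, i, rfl⟩ := ht
  set t := u * cs.simple i * u⁻¹ with ht
  obtain ⟨f, hf⟩ : ∃ f, cs.signedConjHom u⁻¹ (t, e) = (cs.simple i, f) :=
    ⟨_, Prod.ext (by rw [signedConjHom_apply_fst]; simp [ht, mul_assoc]) rfl⟩
  have hs : cs.signedConjHom (cs.simple i) (cs.simple i, f) = (cs.simple i, f + 1) := by
    rw [signedConjHom, lift_apply_simple]
    simp [signedConj]
  have hu : cs.signedConjHom u (cs.simple i, f) = (t, e) := by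
    rw [← hf, ← signedConjHom_mul_apply]
    simp [Function.End.one_def]
  nth_rw 1 [ht]
  rw [signedConjHom_mul_apply, signedConjHom_mul_apply, hf, hs, signedConjHom_apply_add, hu]

theorem mem_rightInvSeq_of_isRightInversion {ω : List B} {t : W}
    (h : cs.IsRightInversion (cs.wordProd ω) t) : t ∈ cs.rightInvSeq ω := by
  classical
  by_contra hmem
  obtain ⟨ht, hlt⟩ := h
  obtain ⟨τ, hτ, hτw⟩ := cs.exists_isReduced (cs.wordProd ω * t)
  have h1 : cs.signedConjHom (cs.wordProd ω * t) (t, 0) =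
      (cs.wordProd ω * t * (cs.wordProd ω)⁻¹, 1) := by
    rw [signedConjHom_mul_apply, ht.signedConjHom_apply, signedConjHom_wordProd,
      List.count_eq_zero_of_not_mem hmem]
    simp
  rw [hτw, signedConjHom_wordProd] at h1
  have hcount : (cs.rightInvSeq τ).count t ≠ 0 := by
    intro h0
    simp [h0] at h1
  have h2 := (cs.isRightInversion_of_mem_rightInvSeq hτ
    (List.count_pos_iff.mp (Nat.pos_of_ne_zero hcount))).2
  rw [← hτw, mul_assoc, ht.mul_self, mul_one] at h2
  omega

/-- The strong exchange property, for right multiplication. -/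
theorem exists_mul_eq_wordProd_eraseIdx {ω : List B} {t : W} (ht : cs.IsReflection t)
    (h : cs.length (cs.wordProd ω * t) < cs.length (cs.wordProd ω)) :
    ∃ j < ω.length, cs.wordProd ω * t = cs.wordProd (ω.eraseIdx j) := by
  obtain ⟨j, hj, rfl⟩ := List.mem_iff_getElem.mp (cs.mem_rightInvSeq_of_isRightInversion ⟨ht, h⟩)
  refine ⟨j, by simpa using hj, ?_⟩
  rw [← List.getD_eq_getElem _ 1 hj, wordProd_mul_getD_rightInvSeq]

/-- The strong exchange property, for left multiplication. -/
theorem exists_mul_wordProd_eq_eraseIdx {ω : List B} {t : W} (ht : cs.IsReflection t)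
    (h : cs.length (t * cs.wordProd ω) < cs.length (cs.wordProd ω)) :
    ∃ j < ω.length, t * cs.wordProd ω = cs.wordProd (ω.eraseIdx j) := by
  have h' : cs.IsRightInversion (cs.wordProd ω.reverse) t := by
    rw [wordProd_reverse, isRightInversion_inv_iff]
    exact ⟨ht, h⟩
  have hmem := cs.mem_rightInvSeq_of_isRightInversion h'
  rw [rightInvSeq_reverse, List.mem_reverse] at hmem
  obtain ⟨j, hj, rfl⟩ := List.mem_iff_getElem.mp hmem
  refine ⟨j, by simpa using hj, ?_⟩
  rw [← List.getD_eq_getElem _ 1 hj, getD_leftInvSeq_mul_wordProd]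

end StrongExchange

section Finiteness

theorem finite_setOf_length_le (hfin : (Set.range cs.simple).Finite) (n : ℕ) :
    {w : W | cs.length w ≤ n}.Finite := by
  induction n with
  | zero => simp [length_eq_zero_iff]
  | succ n ih =>
    refine ((Set.finite_singleton 1).union (Set.Finite.image2 (· * ·) hfin ih)).subset ?_
    intro w hw
    by_cases h1 : w = 1
    · exact Or.inl h1
    · obtain ⟨i, hi⟩ := cs.exists_leftDescent_of_ne_one h1
      refine Or.inr ⟨cs.simple i, ⟨i, rfl⟩, cs.simple i * w, ?_, by simp⟩
      have := cs.isLeftDescent_iff.mp hi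
      simp only [Set.mem_ofPred_eq] at hw ⊢
      omega

/-- `u` is obtained from `w` by left multiplication by a reflection that decreases the length. -/
def BruhatStep (u w : W) : Prop :=
  ∃ t, cs.IsReflection t ∧ u = t * w ∧ cs.length u < cs.length w

variable {cs} in
theorem BruhatStep.simple_mul {u w : W} (h : cs.BruhatStep u w) (i : B) :
    cs.simple i * u = w ∨ cs.BruhatStep (cs.simple i * u) (cs.simple i * w) := by
  obtain ⟨t, ht, rfl, hlt⟩ := h
  have hrefl : cs.IsReflection (cs.simple i * t * (cs.simple i)⁻¹) := ht.conj _
  have heq : cs.simple i * (t * w) = cs.simple i * t * (cs.simple i)⁻¹ * (cs.simple i * w) := by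
    group
  by_cases hle : cs.length (cs.simple i * (t * w)) < cs.length (cs.simple i * w)
  · exact Or.inr ⟨_, hrefl, heq, hle⟩
  left
  have hne : cs.length (cs.simple i * (t * w)) ≠ cs.length (cs.simple i * w) := by
    rw [heq]
    exact hrefl.length_mul_right_ne _
  obtain ⟨v, hv, hvw⟩ := cs.exists_isReduced (cs.simple i * w)
  have hword : cs.wordProd (i :: v) = w := by rw [wordProd_cons, ← hvw]; simp
  rw [← hword] at hlt
  obtain ⟨j, hj, hjeq⟩ := cs.exists_mul_wordProd_eq_eraseIdx ht hlt
  rw [hword] at hjeq hlt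
  cases j with
  | zero =>
    rw [List.eraseIdx_cons_zero] at hjeq
    rw [hjeq, ← wordProd_cons, hword]
  | succ k =>
    exfalso
    rw [List.eraseIdx_cons_succ, wordProd_cons] at hjeq
    have h1 := cs.length_wordProd_le (v.eraseIdx k)
    have h2 : cs.length (cs.simple i * w) = v.length := by rw [hvw]; exact hv
    have h3 : (v.eraseIdx k).length + 1 = v.length :=
      List.length_eraseIdx_add_one (by simpa using hj)
    rw [hjeq, simple_mul_simple_cancel_left] at hle
    omega

theorem length_le_of_forall_isLeftDescent {w : W} (h : ∀ i, cs.IsLeftDescent w i) (u : W) :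
    cs.length u ≤ cs.length w := by
  have hmul (v : W) (i : B) (hv : Relation.ReflTransGen cs.BruhatStep v w) :
      Relation.ReflTransGen cs.BruhatStep (cs.simple i * v) w := by
    induction hv using Relation.ReflTransGen.head_induction_on with
    | refl => exact .single ⟨_, cs.isReflection_simple i, rfl, h i⟩
    | head hstep hrest ih =>
      rcases hstep.simple_mul i with heq | hstep'
      · rwa [heq]
      · exact ih.head hstep'
  have hle (v : W) (hv : Relation.ReflTransGen cs.BruhatStep v w) : cs.length v ≤ cs.length w := by
    induction hv using Relation.ReflTransGen.head_induction_on with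
    | refl => exact le_rfl
    | head hstep hrest ih =>
      obtain ⟨_, _, _, hlt⟩ := hstep
      omega
  have hprod (x v : W) (hv : Relation.ReflTransGen cs.BruhatStep v w) :
      Relation.ReflTransGen cs.BruhatStep (x * v) w := by
    induction x using cs.simple_induction_left with
    | one => simpa
    | mul_simple_left x i ih => rw [mul_assoc]; exact hmul _ i ih
  have := hle _ (hprod (u * w⁻¹) w .refl)
  simpa using this

end Finiteness

section Parabolic

variable {T : Set B}

theorem simple_mem_parabolic {i : B} (hi : i ∈ T) : cs.simple i ∈ cs.parabolic T :=
  Subgroup.subset_closure ⟨i, hi, rfl⟩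

theorem parabolic_mono {T' : Set B} (h : T ⊆ T') : cs.parabolic T ≤ cs.parabolic T' :=
  Subgroup.closure_mono (Set.image_mono h)

theorem wordProd_mem_parabolic {ω : List B} (h : ∀ i ∈ ω, i ∈ T) :
    cs.wordProd ω ∈ cs.parabolic T := by
  refine Subgroup.list_prod_mem _ fun x hx ↦ ?_
  obtain ⟨i, hi, rfl⟩ := List.mem_map.mp hx
  exact cs.simple_mem_parabolic (h i hi)

theorem exists_isReduced_of_mem_parabolic {w : W} (hw : w ∈ cs.parabolic T) :
    ∃ ω : List B, cs.IsReduced ω ∧ cs.wordProd ω = w ∧ ∀ i ∈ ω, i ∈ T := by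
  have hmul (i : B) (hi : i ∈ T) (v : W)
      (hv : ∃ ω : List B, cs.IsReduced ω ∧ cs.wordProd ω = v ∧ ∀ i ∈ ω, i ∈ T) :
      ∃ ω : List B, cs.IsReduced ω ∧ cs.wordProd ω = cs.simple i * v ∧ ∀ i ∈ ω, i ∈ T := by
    obtain ⟨ω, hω, rfl, hT⟩ := hv
    have hlen := hω.eq
    rcases cs.length_simple_mul (cs.wordProd ω) i with h | h
    · refine ⟨i :: ω, ?_, cs.wordProd_cons i ω, ?_⟩
      · rw [IsReduced, wordProd_cons, h, hω.eq, List.length_cons]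
      · simpa [hi] using hT
    · obtain ⟨j, hj, heq⟩ :=
        cs.exists_mul_wordProd_eq_eraseIdx (ω := ω) (cs.isReflection_simple i) (by omega)
      have := List.length_eraseIdx_add_one hj
      refine ⟨ω.eraseIdx j, ?_, heq.symm, fun k hk ↦ hT k (List.mem_of_mem_eraseIdx hk)⟩
      rw [IsReduced, ← heq]
      omega
  induction hw using Subgroup.closure_induction_left with
  | one => exact ⟨[], by simp [IsReduced], by simp, by simp⟩
  | mul_left x hx y hy ih =>
    obtain ⟨i, hi, rfl⟩ := hx
    exact hmul i hi y ih
  | inv_mul_cancel x hx y hy ih =>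
    obtain ⟨i, hi, rfl⟩ := hx
    rw [inv_simple]
    exact hmul i hi y ih

variable {cs}

theorem IsMinRep.length_le {w v : W} (h : cs.IsMinRep T w w) (hv : v ∈ cs.parabolic T) :
    cs.length w ≤ cs.length (w * v) :=
  h.2 _ (by simpa)

theorem IsMinRep.length_mul {w u : W} (h : cs.IsMinRep T w w) (hu : u ∈ cs.parabolic T) :
    cs.length (w * u) = cs.length w + cs.length u := by
  obtain ⟨ω, hω, rfl, hT⟩ := cs.exists_isReduced_of_mem_parabolic hu
  clear hu
  induction ω using List.reverseRecOn with
  | nil => simp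
  | append_singleton ω i ih =>
    have hω' : cs.IsReduced ω := by simpa using hω.take ω.length
    replace ih := ih hω' fun k hk ↦ hT k (by simp [hk])
    have hωT : cs.wordProd ω ∈ cs.parabolic T :=
      cs.wordProd_mem_parabolic fun k hk ↦ hT k (by simp [hk])
    have hred := hω.eq
    have hlen := hω'.eq
    rw [List.length_append, List.length_singleton] at hred
    obtain ⟨τ, hτ, rfl⟩ := cs.exists_isReduced w
    rw [hred]
    rw [wordProd_append, wordProd_singleton] at hred ⊢
    rw [← mul_assoc]
    rcases cs.length_mul_simple (cs.wordProd τ * cs.wordProd ω) i with hup | hdown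
    · omega
    exfalso
    obtain ⟨j, hj, heq⟩ := cs.exists_mul_eq_wordProd_eraseIdx (ω := τ ++ ω)
      (cs.isReflection_simple i) (by rw [wordProd_append]; omega)
    rw [wordProd_append] at heq
    rcases lt_or_ge j τ.length with hjτ | hjτ
    · rw [List.eraseIdx_append_of_lt_length hjτ, wordProd_append] at heq
      have hmem : cs.wordProd ω * cs.simple i * (cs.wordProd ω)⁻¹ ∈ cs.parabolic T :=
        mul_mem (mul_mem hωT (cs.simple_mem_parabolic (hT i (by simp)))) (inv_mem hωT)
      have h1 := h.length_le hmem
      rw [show cs.wordProd τ * (cs.wordProd ω * cs.simple i * (cs.wordProd ω)⁻¹) =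
        cs.wordProd τ * cs.wordProd ω * cs.simple i * (cs.wordProd ω)⁻¹ by group, heq,
        mul_inv_cancel_right] at h1
      have h2 := cs.length_wordProd_le (τ.eraseIdx j)
      have h3 := List.length_eraseIdx_add_one hjτ
      have h4 := hτ.eq
      omega
    · rw [List.eraseIdx_append_of_length_le hjτ, wordProd_append, mul_assoc, mul_right_inj] at heq
      have h2 := cs.length_wordProd_le (ω.eraseIdx (j - τ.length))
      have h3 := List.length_eraseIdx_add_one (l := ω) (i := j - τ.length)
        (by rw [List.length_append] at hj; omega)
      rw [← heq] at h2
      omega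

theorem IsMinRep.self {w u : W} (h : cs.IsMinRep T w u) : cs.IsMinRep T u u := by
  refine ⟨by simp [one_mem], fun v hv ↦ h.2 v ?_⟩
  simpa [mul_assoc] using mul_mem h.1 hv

theorem IsMinRep.length_eq {w u : W} (h : cs.IsMinRep T w u) (h' : cs.IsMinRep T w w) :
    cs.length u = cs.length w :=
  le_antisymm (h.2 w h'.1) (h'.2 u h.1)

theorem IsMinRep.congr {w w' u : W} (h : cs.IsMinRep T w u) (hw : w'⁻¹ * w ∈ cs.parabolic T) :
    cs.IsMinRep T w' u := by
  refine ⟨by simpa [mul_assoc] using mul_mem hw h.1, fun v hv ↦ h.2 v ?_⟩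
  simpa [mul_assoc] using mul_mem (inv_mem hw) hv

variable (cs T) in
theorem exists_isMinRep (w : W) : ∃ u, cs.IsMinRep T w u := by
  obtain ⟨u, hu, hmin⟩ := exists_minimalFor_of_wellFoundedLT
    (fun v ↦ w⁻¹ * v ∈ cs.parabolic T) cs.length ⟨w, by simp [one_mem]⟩
  exact ⟨u, hu, fun v hv ↦ (le_total _ _).elim id (hmin hv)⟩

theorem isMinRep_self_of_forall_length_lt {w : W}
    (h : ∀ i ∈ T, cs.length w < cs.length (w * cs.simple i)) : cs.IsMinRep T w w := by
  obtain ⟨v, hv⟩ := cs.exists_isMinRep T w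
  have hmem : v⁻¹ * w ∈ cs.parabolic T := by simpa using inv_mem hv.1
  obtain ⟨ω, hω, hprod, hT⟩ := cs.exists_isReduced_of_mem_parabolic hmem
  rcases List.eq_nil_or_concat' ω with rfl | ⟨τ, i, rfl⟩
  · rw [wordProd_nil, eq_comm, inv_mul_eq_one] at hprod
    exact hprod ▸ hv
  · exfalso
    have hi := h i (hT i (by simp))
    have hlen := hv.self.length_mul hmem
    have hred := hω.eq
    rw [mul_inv_cancel_left, ← hprod, hred, List.length_append, List.length_singleton] at hlen
    have hw : w * cs.simple i = v * cs.wordProd τ := by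
      rw [wordProd_append, wordProd_singleton, eq_inv_mul_iff_mul_eq] at hprod
      rw [← hprod]
      simp [mul_assoc]
    have h1 := cs.length_mul_le v (cs.wordProd τ)
    have h2 := cs.length_wordProd_le τ
    rw [hw] at hi
    omega

/-- Deodhar's lemma. -/
theorem IsMinRep.simple_mul {w : W} (h : cs.IsMinRep T w w) (i : B) :
    cs.IsMinRep T (cs.simple i * w) (cs.simple i * w) ∨
      ∃ j ∈ T, cs.simple i * w = w * cs.simple j := by
  by_cases hmin : ∀ j ∈ T, cs.length (cs.simple i * w) < cs.length (cs.simple i * w * cs.simple j)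
  · exact Or.inl (isMinRep_self_of_forall_length_lt hmin)
  right
  push Not at hmin
  obtain ⟨j, hj, hle⟩ := hmin
  refine ⟨j, hj, ?_⟩
  have hlen := h.length_mul (cs.simple_mem_parabolic hj)
  rw [length_simple] at hlen
  have h1 := cs.length_simple_mul w i
  have h2 := cs.length_simple_mul (w * cs.simple j) i
  have h3 := cs.length_mul_simple (cs.simple i * w) j
  rw [← mul_assoc] at h2
  obtain ⟨τ, hτ, rfl⟩ := cs.exists_isReduced w
  have h4 := hτ.eq
  obtain ⟨k, hk, heq⟩ := cs.exists_mul_wordProd_eq_eraseIdx (ω := τ ++ [j])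
    (cs.isReflection_simple i) (by
      rw [wordProd_append, wordProd_singleton, ← mul_assoc]
      omega)
  rw [wordProd_append, wordProd_singleton] at heq
  rcases lt_or_ge k τ.length with hkτ | hkτ
  · exfalso
    rw [List.eraseIdx_append_of_lt_length hkτ, wordProd_append, wordProd_singleton, ← mul_assoc,
      mul_left_inj] at heq
    have h5 := cs.length_wordProd_le (τ.eraseIdx k)
    have h6 := List.length_eraseIdx_add_one hkτ
    rw [← heq] at h5
    omega
  · rw [List.length_append, List.length_singleton] at hk
    obtain rfl : k = τ.length := by omega
    rw [List.eraseIdx_append_of_length_le le_rfl] at heq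
    simp only [Nat.sub_self, List.eraseIdx_cons_zero, List.append_nil] at heq
    rw [← cs.simple_mul_simple_cancel_left (w := cs.wordProd τ * cs.simple j) i, heq]

theorem bruhatLE.length_le {u w : W} (h : cs.bruhatLE u w) : cs.length u ≤ cs.length w := by
  obtain ⟨ω, hω, rfl, τ, hτ, rfl⟩ := h
  exact (cs.length_wordProd_le τ).trans (hτ.length_le.trans hω.eq.ge)

theorem bruhatLE_refl (w : W) : cs.bruhatLE w w := by
  obtain ⟨ω, hω, hw⟩ := cs.exists_isReduced w
  exact ⟨ω, hω, hw.symm, ω, List.Sublist.refl ω, hw.symm⟩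

theorem bruhatLE_of_isLeftDescent {w : W} {i : B} (h : cs.IsLeftDescent w i) :
    cs.bruhatLE (cs.simple i * w) w := by
  obtain ⟨ω, hω, hw⟩ := cs.exists_isReduced (cs.simple i * w)
  have hprod : cs.wordProd (i :: ω) = w := by rw [wordProd_cons, ← hw]; simp
  refine ⟨i :: ω, ?_, hprod, ω, List.sublist_cons_self i ω, hw.symm⟩
  rw [IsReduced, hprod, List.length_cons, ← hω.eq, ← hw, cs.isLeftDescent_iff.mp h]

/-- For a minimal representative `w`, the relation `s w W_T ≤ w W_T` holds iff left multiplication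
by `s` shortens `w` or fixes its coset. -/
theorem IsMinRep.bruhatLEQuot_simple_mul_iff {w : W} (h : cs.IsMinRep T w w) (i : B) :
    cs.bruhatLEQuot T (cs.simple i * w) w ↔
      cs.IsLeftDescent w i ∨ ∃ j ∈ T, cs.simple i * w = w * cs.simple j := by
  constructor
  · rintro ⟨u', w', hu', hw', hle⟩
    refine (h.simple_mul i).imp_left fun hmin ↦ ?_
    have h1 := hle.length_le
    rw [hu'.length_eq hmin, hw'.length_eq h] at h1
    exact lt_of_le_of_ne h1 (cs.length_simple_mul_ne w i)
  · have hfix (hex : ∃ j ∈ T, cs.simple i * w = w * cs.simple j) :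
        cs.bruhatLEQuot T (cs.simple i * w) w := by
      obtain ⟨j, hj, heq⟩ := hex
      refine ⟨w, w, h.congr ?_, h, bruhatLE_refl w⟩
      rw [heq]
      simpa using cs.simple_mem_parabolic hj
    rintro (hdesc | hex)
    · rcases h.simple_mul i with hmin | hex
      · exact ⟨_, _, hmin, h, bruhatLE_of_isLeftDescent hdesc⟩
      · exact hfix hex
    · exact hfix hex

/-- If `w W_T` is a maximum for the left action of the simple reflections on `W / W_T` and `W_T` is
finite, then the length function of `W` is bounded. -/
theorem IsMinRep.exists_forall_length_le {w : W} (h : cs.IsMinRep T w w)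
    (hT : (cs.parabolic T : Set W).Finite)
    (hmax : ∀ i, cs.bruhatLEQuot T (cs.simple i * w) w) : ∃ n, ∀ u, cs.length u ≤ n := by
  obtain ⟨x, hx, hxmax⟩ := Set.exists_max_image _ cs.length hT ⟨1, one_mem _⟩
  refine ⟨_, cs.length_le_of_forall_isLeftDescent (w := w * x) fun i ↦ ?_⟩
  have hlen := h.length_mul hx
  rw [IsLeftDescent, hlen, ← mul_assoc]
  rcases (h.bruhatLEQuot_simple_mul_iff i).mp (hmax i) with hdesc | ⟨j, hj, heq⟩
  · have h1 := cs.length_mul_le (cs.simple i * w) x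
    rw [IsLeftDescent] at hdesc
    omega
  · have hmem := mul_mem (cs.simple_mem_parabolic hj) hx
    have h1 := h.length_mul hmem
    have h2 := hxmax _ hmem
    have h3 := cs.length_simple_mul_ne x j
    rw [heq, mul_assoc]
    omega

/-- A longest minimal representative in `W_K` is, up to `W_T`, decreased by every simple reflection
in `K`. -/
theorem IsMinRep.isLeftDescent_or_of_maximal {K : Set B} {w : W} (h : cs.IsMinRep T w w)
    (hw : w ∈ cs.parabolic K)
    (hmax : ∀ v ∈ cs.parabolic K, cs.IsMinRep T v v → cs.length v ≤ cs.length w)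
    {i : B} (hi : i ∈ K) :
    cs.IsLeftDescent w i ∨ ∃ j ∈ T, cs.simple i * w = w * cs.simple j :=
  (h.simple_mul i).imp_left fun hmin ↦
    lt_of_le_of_ne (hmax _ (mul_mem (cs.simple_mem_parabolic hi) hw) hmin)
      (cs.length_simple_mul_ne w i)

/-- If `x ∈ W_K` is minimal in `x W_{K ∩ L}` and `y ∈ W_L`, then the product `x y` is
length-additive, provided no simple reflection outside `L` lies in `W_L`. -/
theorem IsMinRep.length_mul_of_mem {K L : Set B} {x y : W} (h : cs.IsMinRep (K ∩ L) x x)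
    (hx : x ∈ cs.parabolic K) (hy : y ∈ cs.parabolic L)
    (hL : ∀ i ∉ L, cs.simple i ∉ cs.parabolic L) :
    cs.length (x * y) = cs.length x + cs.length y := by
  obtain ⟨v, hv⟩ := cs.exists_isMinRep (K ∩ L) y⁻¹
  have hu : y * v ∈ cs.parabolic (K ∩ L) := by simpa using hv.1
  have hvL : v ∈ cs.parabolic L := by
    simpa using mul_mem (inv_mem hy) (cs.parabolic_mono Set.inter_subset_right hu)
  have hvK : cs.IsMinRep K v v := by
    refine isMinRep_self_of_forall_length_lt fun i hi ↦ ?_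
    by_cases hiL : i ∈ L
    · rw [hv.self.length_mul (cs.simple_mem_parabolic ⟨hi, hiL⟩), length_simple]
      exact Nat.lt_succ_self _
    · by_contra hlt
      obtain ⟨ω, hω, rfl, hωL⟩ := cs.exists_isReduced_of_mem_parabolic hvL
      obtain ⟨j, hj, heq⟩ := cs.exists_mul_eq_wordProd_eraseIdx (ω := ω) (cs.isReflection_simple i)
        (lt_of_le_of_ne (not_lt.mp hlt) (cs.length_mul_simple_ne _ i))
      refine hL i hiL ?_
      rw [← eq_inv_mul_iff_mul_eq] at heq
      rw [heq]
      exact mul_mem (inv_mem hvL)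
        (cs.wordProd_mem_parabolic fun k hk ↦ hωL k (List.mem_of_mem_eraseIdx hk))
  have h1 := h.length_mul hu
  have h2 := hv.self.length_mul (inv_mem hu)
  have h3 := hvK.length_mul
    (inv_mem (mul_mem hx (cs.parabolic_mono Set.inter_subset_left hu)))
  rw [show v * (y * v)⁻¹ = y⁻¹ by group, length_inv, length_inv] at h2
  rw [show v * (x * (y * v))⁻¹ = (x * y)⁻¹ by group, length_inv, length_inv] at h3
  omega

end Parabolic

end CoxeterSystem

/-- With `a ≠ b` in `B`, `J = S \ {a, b}`, and `w_a`, `w_b` the maximal-length elements of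
`W_{S_a}^J` and `W_{S_b}^J` (assumed finite parabolics), and `W` infinite:
`D^J(w_a w_b) = S_a`, i.e. for `s ∈ S` one has
`s (w_a w_b) W_J ≤_J (w_a w_b) W_J` iff `s ≠ a`. -/
theorem descent_set_of_product_eq
    {B : Type*} {W : Type*} [Group W] {M : CoxeterMatrix B} (cs : CoxeterSystem M W)
    (hW : Infinite W)
    (a b : B) (hab : a ≠ b)
    (hfina : (↑(cs.parabolic {a}ᶜ) : Set W).Finite)
    (hfinb : (↑(cs.parabolic {b}ᶜ) : Set W).Finite)
    (wa : W) (hwa_mem : wa ∈ cs.parabolic {a}ᶜ)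
    (hwa_min : cs.IsMinRep ({a, b}ᶜ) wa wa)
    (hwa_max : ∀ v ∈ cs.parabolic {a}ᶜ, cs.IsMinRep ({a, b}ᶜ) v v →
      cs.length v ≤ cs.length wa)
    (wb : W) (hwb_mem : wb ∈ cs.parabolic {b}ᶜ)
    (hwb_min : cs.IsMinRep ({a, b}ᶜ) wb wb)
    (hwb_max : ∀ v ∈ cs.parabolic {b}ᶜ, cs.IsMinRep ({a, b}ᶜ) v v →
      cs.length v ≤ cs.length wb) :
    ∀ s : B, cs.bruhatLEQuot ({a, b}ᶜ) (cs.simple s * (wa * wb)) (wa * wb) ↔ s ≠ a := by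
  have hJ : ({a}ᶜ ∩ {b}ᶜ : Set B) = {a, b}ᶜ := by ext; simp
  have hfin_simple : (Set.range cs.simple).Finite := by
    refine ((hfina.subset Subgroup.subset_closure).insert (cs.simple a)).subset ?_
    rintro _ ⟨i, rfl⟩
    by_cases hi : i = a
    · exact Or.inl (hi ▸ rfl)
    · exact Or.inr ⟨i, hi, rfl⟩
  have hb : ∀ i ∉ ({b}ᶜ : Set B), cs.simple i ∉ cs.parabolic {b}ᶜ := by
    intro i hi hmem
    obtain rfl : i = b := by simpa using hi
    have htop : cs.parabolic {i}ᶜ = ⊤ := by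
      rw [eq_top_iff, ← cs.subgroup_closure_range_simple, Subgroup.closure_le]
      rintro _ ⟨k, rfl⟩
      by_cases hk : k = i
      · exact hk ▸ hmem
      · exact cs.simple_mem_parabolic hk
    rw [htop, Subgroup.coe_top] at hfinb
    exact Set.infinite_univ hfinb
  have hadd (y : W) (hy : y ∈ cs.parabolic {b}ᶜ) :
      cs.length (wa * y) = cs.length wa + cs.length y :=
    CoxeterSystem.IsMinRep.length_mul_of_mem (hJ.symm ▸ hwa_min) hwa_mem hy hb
  have hmin : cs.IsMinRep ({a, b}ᶜ) (wa * wb) (wa * wb) := by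
    refine CoxeterSystem.isMinRep_self_of_forall_length_lt fun j hj ↦ ?_
    have hjb : j ∈ ({b}ᶜ : Set B) := fun h ↦ hj (Or.inr h)
    have h1 := hwb_min.length_mul (cs.simple_mem_parabolic hj)
    rw [cs.length_simple] at h1
    rw [mul_assoc, hadd _ hwb_mem, hadd _ (mul_mem hwb_mem (cs.simple_mem_parabolic hjb))]
    omega
  have hdesc (s : B) (hs : s ≠ a) :
      cs.bruhatLEQuot ({a, b}ᶜ) (cs.simple s * (wa * wb)) (wa * wb) := by
    rw [hmin.bruhatLEQuot_simple_mul_iff, CoxeterSystem.IsLeftDescent, hadd _ hwb_mem, ← mul_assoc]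
    rcases hwa_min.isLeftDescent_or_of_maximal hwa_mem hwa_max (i := s) hs with hlt | ⟨j, hj, heq⟩
    · have h1 := cs.length_mul_le (cs.simple s * wa) wb
      rw [CoxeterSystem.IsLeftDescent] at hlt
      exact Or.inl (by omega)
    · have hjb : j ∈ ({b}ᶜ : Set B) := fun h ↦ hj (Or.inr h)
      rw [heq, mul_assoc]
      refine (hwb_min.isLeftDescent_or_of_maximal hwb_mem hwb_max hjb).imp (fun hlt ↦ ?_) ?_
      · have h1 := cs.length_mul_le wa (cs.simple j * wb)
        rw [CoxeterSystem.IsLeftDescent] at hlt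
        omega
      · rintro ⟨k, hk, hk'⟩
        exact ⟨k, hk, by rw [hk', mul_assoc]⟩
  intro s
  refine ⟨?_, hdesc s⟩
  rintro hs rfl
  have hJfin : (cs.parabolic {s, b}ᶜ : Set W).Finite :=
    hfina.subset (cs.parabolic_mono fun i hi h ↦ hi (Or.inl h))
  obtain ⟨n, hn⟩ := hmin.exists_forall_length_le hJfin fun i ↦
    (eq_or_ne i s).elim (fun hi ↦ hi ▸ hs) (hdesc i)
  exact Set.infinite_univ ((cs.finite_setOf_length_le hfin_simple n).subset fun u _ ↦ hn u)
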